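/- There is a universal constant C > 0 with the following property. Let P ∈ ℕ₊ and let 𝓜⁽¹⁾, 𝓜⁽²⁾ be two RMMDPs over the same 𝒮, 𝒜, 𝒵 and horizon H, with the same transition kernel T and initial distribution ν, each with M latent contexts, and suppose all reward probabilities are integral, i.e. every μ_m⁽ᵇ⁾(x,z) lies in {0, 1/P, 2/P, …, 1}. Set d := min(d_P, H) where d_P := ⌊ln(2M)/ln((P+1)/P)⌋ + 1. Let n(·) assign a nonnegative count to every state–action sequence of length at most d, let n_l > 0, define X_l := { x : n(x) ≥ n_l }, E_l := { x_{1:H} : every subsequence of x_{1:H} of length at most d lies in X_l }, and δ_l := max over length-d sequences x ∈ X_l, z ∈ 𝒵^d, I ⊆ {1,…,d} of |𝐌⁽¹⁾(x_I,z_I) − 𝐌⁽²⁾(x_I,z_I)|. Then for every subset E′ ⊆ E_l and every history-dependent policy π: Σ_{τ : x_{1:H} ∈ E′} |P⁽¹⁾_π(τ) − P⁽²⁾_π(τ)| ≤ (sup_{π'} P⁽¹⁾_{π'}(x_{1:H} ∈ E′)) · (2M)^{C·M·P·ln(P+1)} · δ_l. -/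

import Mathlib

open Finset

/-- A probability distribution on a finite type. -/
def IsDist {X : Type*} [Fintype X] (p : X → ℝ) : Prop :=
  (∀ x, 0 ≤ p x) ∧ ∑ x, p x = 1

/-- A history-dependent policy: each history (past state-action-reward triples together
with the current state) is assigned a probability distribution over actions. -/
def IsPolicy {S A Z : Type*} [Fintype A]
    (π : List ((S × A) × Z) → S → A → ℝ) : Prop :=
  ∀ hist s, (∀ a, 0 ≤ π hist s a) ∧ ∑ a, π hist s a = 1

/-- A latent reward model: for each context and state-action pair, a distribution on rewards. -/
def IsRewardModel {X Z : Type*} [Fintype Z] {M : ℕ}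
    (μ : Fin M → X → Z → ℝ) : Prop :=
  ∀ m x, (∀ z, 0 ≤ μ m x z) ∧ ∑ z, μ m x z = 1

/-- The mixture moment `𝐌(x_I, z_I) = Σ_m w_m Π_{i ∈ I} μ_m(x_i, z_i)`. -/
def momentOn {X Z : Type*} {M d : ℕ} (w : Fin M → ℝ) (μ : Fin M → X → Z → ℝ)
    (x : Fin d → X) (z : Fin d → Z) (I : Finset (Fin d)) : ℝ :=
  ∑ m, w m * ∏ i ∈ I, μ m (x i) (z i)

/-- Probability of a length-`H` trajectory `τ = ((s_t,a_t),r_t)_{t}` under a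
history-dependent policy `π` in an RMMDP with transitions `T`, initial distribution `ν`,
mixing weights `w` and reward models `μ`. -/
noncomputable def trajProb {S A Z : Type*} (H : ℕ)
    (T : S × A → S → ℝ) (ν : S → ℝ)
    (π : List ((S × A) × Z) → S → A → ℝ)
    {M : ℕ} (w : Fin M → ℝ) (μ : Fin M → S × A → Z → ℝ)
    (τ : Fin H → (S × A) × Z) : ℝ :=
  (if h : 0 < H then ν ((τ ⟨0, h⟩).1.1) else 1)
    * (∏ t : Fin H, if h : (t : ℕ) + 1 < H then T (τ t).1 ((τ ⟨(t : ℕ) + 1, h⟩).1.1) else 1)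
    * (∏ t : Fin H, π ((List.ofFn τ).take t.val) (τ t).1.1 (τ t).1.2)
    * momentOn w μ (fun t => (τ t).1) (fun t => (τ t).2) Finset.univ

/-- `P_π(x_{1:H} ∈ E)`: total probability of trajectories whose state-action part lies in `E`. -/
noncomputable def eventProb {S A Z : Type*} [Fintype S] [Fintype A] [Fintype Z]
    [DecidableEq S] [DecidableEq A] (H : ℕ)
    (T : S × A → S → ℝ) (ν : S → ℝ)
    (π : List ((S × A) × Z) → S → A → ℝ)
    {M : ℕ} (w : Fin M → ℝ) (μ : Fin M → S × A → Z → ℝ)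
    (E : Finset (Fin H → S × A)) : ℝ :=
  ∑ τ : Fin H → (S × A) × Z,
    if (fun t => (τ t).1) ∈ E then trajProb H T ν π w μ τ else 0

/-- `sup_π P_π(x_{1:H} ∈ E)`, supremum over all history-dependent policies. -/
noncomputable def supEventProb {S A Z : Type*} [Fintype S] [Fintype A] [Fintype Z]
    [DecidableEq S] [DecidableEq A] (H : ℕ)
    (T : S × A → S → ℝ) (ν : S → ℝ)
    {M : ℕ} (w : Fin M → ℝ) (μ : Fin M → S × A → Z → ℝ)
    (E : Finset (Fin H → S × A)) : ℝ :=
  ⨆ π : {p : List ((S × A) × Z) → S → A → ℝ // IsPolicy p},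
    eventProb H T ν π.1 w μ E

/-- A nonzero determinant whose entries are all integral multiples of `1 / Q` is at least
`1 / Q ^ N` in absolute value. -/
lemma one_le_pow_mul_abs_det {K : Type*} [Fintype K] [DecidableEq K] (A : Matrix K K ℝ)
    (Q : ℝ) (hQ : 1 ≤ Q) (hA : ∀ i j, ∃ l : ℤ, Q * A i j = l) (hdet : A.det ≠ 0) :
    1 ≤ Q ^ Fintype.card K * |A.det| := by
  choose l hl using hA
  have h1 : Q ^ Fintype.card K * A.det = ((Matrix.of l).det : ℤ) := by
    rw [← Matrix.det_smul, Int.cast_det]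
    congr 1
    ext i j
    simp [hl]
  have h2 : (Matrix.of l).det ≠ 0 := by
    intro h
    rw [h] at h1
    have : Q ^ Fintype.card K ≠ 0 := by positivity
    simp_all
  have h3 : (1 : ℝ) ≤ |((Matrix.of l).det : ℝ)| := by
    exact_mod_cast Int.one_le_abs h2
  rwa [← h1, abs_mul, abs_of_nonneg (by positivity)] at h3

/-- Quantitative Cramer rule for square systems with entries in `[-1, 1] ∩ ℤ / Q`. -/
lemma abs_coeff_le_of_mulVec_eq {K : Type*} [Fintype K] [DecidableEq K] (A : Matrix K K ℝ)
    (Q : ℝ) (hQ : 1 ≤ Q) (hA : ∀ i j, ∃ l : ℤ, Q * A i j = l) (hA1 : ∀ i j, |A i j| ≤ 1)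
    (hdet : A.det ≠ 0) (a u : K → ℝ) (h : A.mulVec a = u) (j : K) :
    |a j| ≤ (Fintype.card K).factorial * Q ^ Fintype.card K * ∑ k, |u k| := by
  have h1 : A.det * a j = ∑ k, A.adjugate j k * u k := by
    have := congrArg (fun f => f j) (congrArg A.adjugate.mulVec h)
    simp only [Matrix.mulVec_mulVec, Matrix.adjugate_mul, Matrix.smul_mulVec,
      Matrix.one_mulVec, Pi.smul_apply, smul_eq_mul] at this
    rw [this]
    rfl
  have h2 : ∀ k, |A.adjugate j k| ≤ (Fintype.card K).factorial := by
    intro k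
    rw [Matrix.adjugate_apply]
    have := Matrix.det_le (A := A.updateRow k (Pi.single j 1)) (abv := AbsoluteValue.abs)
      (x := (1 : ℝ)) (by
        intro p q
        rw [AbsoluteValue.abs_apply, Matrix.updateRow_apply]
        split_ifs
        · by_cases hq : q = j
          · subst hq; simp
          · simp [hq]
        · exact hA1 p q)
    simpa using this
  have h3 : |A.det| * |a j| ≤ (Fintype.card K).factorial * ∑ k, |u k| := by
    rw [← abs_mul, h1, mul_sum]
    refine (abs_sum_le_sum_abs _ _).trans (sum_le_sum fun k _ => ?_)
    rw [abs_mul]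
    exact mul_le_mul_of_nonneg_right (h2 k) (abs_nonneg _)
  have h4 := one_le_pow_mul_abs_det A Q hQ hA hdet
  calc |a j| ≤ Q ^ Fintype.card K * |A.det| * |a j| :=
        le_mul_of_one_le_left (abs_nonneg _) h4
    _ = Q ^ Fintype.card K * (|A.det| * |a j|) := by ring
    _ ≤ Q ^ Fintype.card K * ((Fintype.card K).factorial * ∑ k, |u k|) := by gcongr
    _ = _ := by ring

/-- A linear functional that is small on a set of vectors with entries in `[-1, 1] ∩ ℤ / Q` is
small on the span of that set, relative to the `ℓ¹` norm. -/
lemma abs_functional_le_of_mem_span {K : Type*} [Fintype K] [DecidableEq K]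
    (t : Set (K → ℝ)) (Q : ℕ) (hQ : 1 ≤ Q) (ht1 : ∀ v ∈ t, ∀ k, |v k| ≤ 1)
    (htQ : ∀ v ∈ t, ∀ k, ∃ l : ℤ, (Q : ℝ) * v k = l) (c : K → ℝ) (δ : ℝ) (hδ : 0 ≤ δ)
    (hc : ∀ v ∈ t, |∑ k, c k * v k| ≤ δ) (u : K → ℝ) (hu : u ∈ Submodule.span ℝ t) :
    |∑ k, c k * u k| ≤ (Fintype.card K) * ((Fintype.card K).factorial *
      (Q : ℝ) ^ Fintype.card K * ∑ k, |u k|) * δ := by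
  obtain ⟨b, hbt, hspan, hb⟩ := exists_linearIndependent ℝ t
  obtain ⟨B, hBt, hbB, hBspan, hB⟩ := exists_linearIndepOn_extension (v := id)
    (t := b ∪ Set.range fun k : K => (Pi.single k 1 : K → ℝ)) hb Set.subset_union_left
  rw [Set.image_id, Set.image_id] at hBspan
  have htop : ⊤ ≤ Submodule.span ℝ (Set.range fun x : B => id (x : K → ℝ)) := by
    simp only [id, Subtype.range_coe]
    rw [← (Pi.basisFun ℝ K).span_eq, Submodule.span_le]
    rintro _ ⟨k, rfl⟩
    apply hBspan
    right
    exact ⟨k, by simp⟩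
  let e : B ≃ K := (Module.Basis.mk hB htop).indexEquiv (Pi.basisFun ℝ K)
  let A : Matrix K K ℝ := fun i => (e.symm i : K → ℝ)
  have hdet : A.det ≠ 0 := by
    have : LinearIndependent ℝ A.row := hB.comp e.symm e.symm.injective
    rw [Matrix.linearIndependent_rows_iff_isUnit, Matrix.isUnit_iff_isUnit_det] at this
    exact this.ne_zero
  have hAmem : ∀ i, A i ∈ t ∨ ∃ k : K, (Pi.single k 1 : K → ℝ) = A i := fun i =>
    (hBt (e.symm i).2).imp (fun h => hbt h) id
  have hA1 : ∀ i j, |A i j| ≤ 1 := by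
    intro i j
    rcases hAmem i with h | ⟨k, h⟩
    · exact ht1 _ h j
    · rw [← h]
      by_cases hj : j = k
      · subst hj; simp
      · simp [hj]
  have hAQ : ∀ i j, ∃ l : ℤ, (Q : ℝ) * A i j = l := by
    intro i j
    rcases hAmem i with h | ⟨k, h⟩
    · exact htQ _ h j
    · rw [← h]
      by_cases hj : j = k
      · subst hj; exact ⟨Q, by simp⟩
      · exact ⟨0, by simp [hj]⟩
  obtain ⟨a, hab, hau⟩ : ∃ a : K → ℝ, (∀ i, a i ≠ 0 → A i ∈ b) ∧ ∑ i, a i • A i = u := by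
    rw [← hspan] at hu
    induction hu using Submodule.span_induction with
    | mem v hv =>
      refine ⟨Pi.single (e ⟨v, hbB hv⟩) 1, fun i hi => ?_, ?_⟩
      · obtain rfl : i = e ⟨v, hbB hv⟩ := by
          by_contra h
          simp [h] at hi
        simpa [A] using hv
      · simp [Pi.single_apply, A]
    | zero => exact ⟨0, by simp, by simp⟩
    | add v w _ _ hv hw =>
      obtain ⟨a, ha, rfl⟩ := hv
      obtain ⟨a', ha', rfl⟩ := hw
      refine ⟨a + a', fun i hi => ?_, by simp [add_smul, sum_add_distrib]⟩
      by_cases h : a i = 0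
      · exact ha' i (by simpa [h] using hi)
      · exact ha i h
    | smul r v _ hv =>
      obtain ⟨a, ha, rfl⟩ := hv
      refine ⟨r • a, fun i hi => ha i fun h => hi (by simp [h]), ?_⟩
      simp [smul_sum, smul_smul]
  have hbound : ∀ j, |a j| ≤ (Fintype.card K).factorial * (Q : ℝ) ^ Fintype.card K *
      ∑ k, |u k| := by
    refine abs_coeff_le_of_mulVec_eq A.transpose Q (by exact_mod_cast hQ) (fun i j => hAQ j i)
      (fun i j => hA1 j i) (by rwa [Matrix.det_transpose]) a u ?_
    rw [← hau]
    ext k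
    simp [Matrix.mulVec, dotProduct, mul_comm]
  have hsum : ∑ k, c k * u k = ∑ i, a i * ∑ k, c k * A i k := by
    rw [← hau]
    simp only [Finset.sum_apply, Pi.smul_apply, smul_eq_mul, mul_sum]
    rw [sum_comm]
    exact sum_congr rfl fun i _ => sum_congr rfl fun k _ => by ring
  rw [hsum]
  refine (abs_sum_le_sum_abs _ _).trans ?_
  rw [mul_assoc, ← nsmul_eq_mul, Fintype.card]
  refine sum_le_card_nsmul _ _ _ fun i _ => ?_
  rw [abs_mul]
  by_cases h : a i = 0
  · rw [h, abs_zero, zero_mul]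
    positivity
  · exact mul_le_mul (hbound i) (hc _ (hbt (hab i h))) (abs_nonneg _)
      ((abs_nonneg _).trans (hbound i))

/-- Greedily choosing a most common value at each coordinate of `D` leaves few functions that
avoid all chosen values. -/
lemma exists_card_avoiding_le {K ι : Type*} [Fintype K] [DecidableEq ι] (P : ℕ)
    (f : K → ι → Fin (P + 1)) (D : Finset ι) :
    ∃ q : ι → Fin (P + 1),
      #{k | ∀ i ∈ D, f k i ≠ q i} * (P + 1) ^ #D ≤ P ^ #D * Fintype.card K := by
  induction D using Finset.induction_on with
  | empty => exact ⟨fun _ => 0, by simp⟩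
  | insert i D hi ih =>
    obtain ⟨q, hq⟩ := ih
    set R : Finset K := {k | ∀ j ∈ D, f k j ≠ q j} with hR
    obtain ⟨y, hy⟩ : ∃ y, #R ≤ (P + 1) * #{k ∈ R | f k i = y} := by
      by_contra! h
      have h1 := card_eq_sum_card_fiberwise (f := fun k => f k i) (s := R)
        (t := univ) (fun _ _ => by simp)
      have h2 := sum_lt_sum_of_nonempty (s := (univ : Finset (Fin (P + 1)))) univ_nonempty
        fun y _ => h y
      rw [← mul_sum, ← h1] at h2
      simp at h2
    refine ⟨Function.update q i y, ?_⟩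
    have hset : ({k | ∀ j ∈ insert i D, f k j ≠ Function.update q i y j} : Finset K) =
        {k ∈ R | ¬ f k i = y} := by
      ext k
      simp only [hR, mem_filter, mem_univ, true_and, mem_insert, forall_eq_or_imp,
        Function.update_self]
      have : ∀ j ∈ D, Function.update q i y j = q j := fun j hj =>
        Function.update_of_ne (by rintro rfl; exact hi hj) _ _
      constructor
      · rintro ⟨h1, h2⟩
        exact ⟨fun j hj => this j hj ▸ h2 j hj, h1⟩
      · rintro ⟨h1, h2⟩
        exact ⟨h2, fun j hj => (this j hj).symm ▸ h1 j hj⟩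
    have hadd := card_filter_add_card_filter_not (s := R) (fun k => f k i = y)
    rw [hset, card_insert_of_notMem hi, pow_succ, pow_succ]
    have hle : #{k ∈ R | ¬ f k i = y} * (P + 1) ≤ P * #R := by nlinarith
    calc _ = #{k ∈ R | ¬ f k i = y} * (P + 1) * (P + 1) ^ #D := by ring
      _ ≤ P * #R * (P + 1) ^ #D := by gcongr
      _ = P * (#R * (P + 1) ^ #D) := by ring
      _ ≤ P * (P ^ #D * Fintype.card K) := by gcongr
      _ = _ := by ring

/-- Monomials in functions with at most `P + 1` values are spanned by those of low degree. -/
lemma monomial_mem_span_card_le {K ι : Type*} [Fintype K] [DecidableEq ι] (P : ℕ)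
    (v : K → ι → ℝ) (hv : ∀ k i, ∃ j : ℕ, j ≤ P ∧ v k i = (j : ℝ) / P) (e : ℕ)
    (he : P ^ e * Fintype.card K < (P + 1) ^ e) (J : Finset ι) :
    (fun k => ∏ i ∈ J, v k i) ∈
      Submodule.span ℝ {u : K → ℝ | ∃ I : Finset ι, #I ≤ e ∧ u = fun k => ∏ i ∈ I, v k i} := by
  choose j hjP hj using hv
  induction hn : #J using Nat.strong_induction_on generalizing J with
  | _ n ih =>
  by_cases hJ : #J ≤ e
  · exact Submodule.subset_span ⟨J, hJ, rfl⟩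
  obtain ⟨D, hDJ, hD⟩ := exists_subset_card_eq (not_le.mp hJ).le
  obtain ⟨q, hq⟩ := exists_card_avoiding_le P
    (fun k i => (⟨j k i, Nat.lt_succ_of_le (hjP k i)⟩ : Fin (P + 1))) D
  rw [hD] at hq
  have hvanish : ∀ k, ∏ i ∈ D, (v k i + -((q i : ℕ) / P : ℝ)) = 0 := by
    intro k
    by_contra h
    have hk : k ∈ ({k | ∀ i ∈ D, (⟨j k i, Nat.lt_succ_of_le (hjP k i)⟩ : Fin (P + 1)) ≠ q i} :
        Finset K) := by
      simp only [mem_filter, mem_univ, true_and]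
      intro i hi heq
      refine h (prod_eq_zero hi ?_)
      rw [hj, ← heq]
      simp
    have := card_pos.mpr ⟨k, hk⟩
    have h2 := Nat.mul_le_mul_right ((P + 1) ^ e) this
    rw [Nat.succ_eq_add_one, zero_add, one_mul] at h2
    omega
  have hexp : (fun k => ∏ i ∈ J, v k i) = -∑ I ∈ D.powerset.erase D,
      (∏ i ∈ D \ I, -((q i : ℕ) / P : ℝ)) • fun k => ∏ i ∈ (J \ D) ∪ I, v k i := by
    ext k
    have h0 := hvanish k
    rw [prod_add, ← add_sum_erase _ _ (mem_powerset_self D)] at h0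
    simp only [_root_.sdiff_self, bot_eq_empty, prod_empty, mul_one] at h0
    rw [← prod_sdiff hDJ, eq_neg_of_add_eq_zero_left h0]
    simp only [Pi.neg_apply, Finset.sum_apply, Pi.smul_apply, smul_eq_mul, mul_neg, mul_sum]
    congr 1
    refine sum_congr rfl fun I hI => ?_
    have hID : I ⊆ D := mem_powerset.mp (mem_of_mem_erase hI)
    rw [prod_union (disjoint_of_subset_right hID sdiff_disjoint)]
    ring
  rw [hexp]
  refine Submodule.neg_mem _ (Submodule.sum_mem _ fun I hI => Submodule.smul_mem _ _ ?_)
  refine ih _ ?_ _ rfl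
  have hI' := mem_erase.mp hI
  rw [← hn]
  refine card_lt_card ⟨union_subset sdiff_subset ((mem_powerset.mp hI'.2).trans hDJ), ?_⟩
  intro hsub
  refine hI'.1 (Subset.antisymm (mem_powerset.mp hI'.2) fun i hi => ?_)
  rcases mem_union.mp (hsub (hDJ hi)) with h | h
  · exact absurd hi (mem_sdiff.mp h).2
  · exact h

/-- The initial-state and transition part of the trajectory probability. -/
noncomputable def dynWeight {S A : Type*} (H : ℕ) (T : S × A → S → ℝ) (ν : S → ℝ)
    (x : Fin H → S × A) : ℝ :=
  (if h : 0 < H then ν ((x ⟨0, h⟩).1) else 1)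
    * ∏ t : Fin H, if h : (t : ℕ) + 1 < H then T (x t) ((x ⟨(t : ℕ) + 1, h⟩).1) else 1

/-- The product of the action probabilities along a trajectory. -/
noncomputable def policyWeight {S A Z : Type*} {H : ℕ}
    (π : List ((S × A) × Z) → S → A → ℝ) (τ : Fin H → (S × A) × Z) : ℝ :=
  ∏ t : Fin H, π ((List.ofFn τ).take t.val) (τ t).1.1 (τ t).1.2

lemma trajProb_eq {S A Z : Type*} (H : ℕ) (T : S × A → S → ℝ) (ν : S → ℝ)
    (π : List ((S × A) × Z) → S → A → ℝ) {M : ℕ} (w : Fin M → ℝ) (μ : Fin M → S × A → Z → ℝ)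
    (τ : Fin H → (S × A) × Z) :
    trajProb H T ν π w μ τ = dynWeight H T ν (fun t => (τ t).1) * policyWeight π τ *
      momentOn w μ (fun t => (τ t).1) (fun t => (τ t).2) univ := rfl

lemma IsDist.le_one {X : Type*} [Fintype X] {p : X → ℝ} (hp : IsDist p) (x : X) : p x ≤ 1 :=
  hp.2 ▸ single_le_sum (fun y _ => hp.1 y) (mem_univ x)

lemma dynWeight_nonneg {S A : Type*} [Fintype S] {H : ℕ} {T : S × A → S → ℝ} {ν : S → ℝ}
    (hT : ∀ x, IsDist (T x)) (hν : IsDist ν) (x : Fin H → S × A) : 0 ≤ dynWeight H T ν x := by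
  refine mul_nonneg ?_ (prod_nonneg fun t _ => ?_)
  · split_ifs
    · exact hν.1 _
    · exact zero_le_one
  · split_ifs
    · exact (hT _).1 _
    · exact zero_le_one

lemma dynWeight_le_one {S A : Type*} [Fintype S] {H : ℕ} {T : S × A → S → ℝ} {ν : S → ℝ}
    (hT : ∀ x, IsDist (T x)) (hν : IsDist ν) (x : Fin H → S × A) : dynWeight H T ν x ≤ 1 := by
  have hprod : ∏ t : Fin H, (if h : (t : ℕ) + 1 < H then T (x t) ((x ⟨(t : ℕ) + 1, h⟩).1)
      else 1) ∈ Set.Icc (0 : ℝ) 1 := by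
    have hmem : ∀ t : Fin H, (if h : (t : ℕ) + 1 < H then T (x t) ((x ⟨(t : ℕ) + 1, h⟩).1)
        else 1) ∈ Set.Icc (0 : ℝ) 1 := by
      intro t
      split_ifs
      · exact ⟨(hT _).1 _, (hT _).le_one _⟩
      · exact ⟨zero_le_one, le_rfl⟩
    exact ⟨prod_nonneg fun t _ => (hmem t).1,
      prod_le_one (fun t _ => (hmem t).1) fun t _ => (hmem t).2⟩
  refine mul_le_one₀ ?_ hprod.1 hprod.2
  split_ifs
  · exact hν.le_one _
  · exact le_rfl

lemma policyWeight_nonneg {S A Z : Type*} [Fintype A] {H : ℕ}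
    {π : List ((S × A) × Z) → S → A → ℝ} (hπ : IsPolicy π) (τ : Fin H → (S × A) × Z) :
    0 ≤ policyWeight π τ :=
  prod_nonneg fun _ _ => (hπ _ _).1 _

lemma policyWeight_le_one {S A Z : Type*} [Fintype A] {H : ℕ}
    {π : List ((S × A) × Z) → S → A → ℝ} (hπ : IsPolicy π) (τ : Fin H → (S × A) × Z) :
    policyWeight π τ ≤ 1 :=
  prod_le_one (fun _ _ => (hπ _ _).1 _) fun _ _ => IsDist.le_one (hπ _ _) _

lemma momentOn_le_one {X Z : Type*} [Fintype Z] {M d : ℕ} {w : Fin M → ℝ}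
    {μ : Fin M → X → Z → ℝ} (hw : IsDist w) (hμ : IsRewardModel μ) (x : Fin d → X)
    (z : Fin d → Z) (I : Finset (Fin d)) : momentOn w μ x z I ≤ 1 := by
  rw [← hw.2]
  refine sum_le_sum fun m _ => mul_le_of_le_one_right (hw.1 m) ?_
  exact prod_le_one (fun i _ => (hμ m (x i)).1 _) fun i _ => IsDist.le_one (hμ m (x i)) _

lemma sum_prod_eq_one {X Z : Type*} [Fintype Z] {d : ℕ} {g : X → Z → ℝ}
    (hg : ∀ x, IsDist (g x)) (x : Fin d → X) : ∑ z : Fin d → Z, ∏ t, g (x t) (z t) = 1 := by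
  classical
  rw [← Fintype.prod_sum (fun t z => g (x t) z)]
  exact prod_eq_one fun t _ => (hg (x t)).2

lemma sum_momentOn_univ {X Z : Type*} [Fintype Z] {M d : ℕ} {w : Fin M → ℝ}
    {μ : Fin M → X → Z → ℝ} (hw : IsDist w) (hμ : IsRewardModel μ) (x : Fin d → X) :
    ∑ z : Fin d → Z, momentOn w μ x z univ = 1 := by
  simp only [momentOn]
  rw [sum_comm, ← hw.2]
  refine sum_congr rfl fun m _ => ?_
  rw [← mul_sum, sum_prod_eq_one (hμ m), mul_one]

/-- The total weight of the action sequence of `xs`, played by `π` after the history `h` while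
rewards are drawn from `g`. -/
noncomputable def simWeight {S A Z : Type*} [Fintype Z] (π : List ((S × A) × Z) → S → A → ℝ)
    (g : S × A → Z → ℝ) : List ((S × A) × Z) → List (S × A) → ℝ
  | _, [] => 1
  | h, x :: xs => π h x.1 x.2 * ∑ z, g x z * simWeight π g (h ++ [(x, z)]) xs

lemma simWeight_nonneg {S A Z : Type*} [Fintype A] [Fintype Z]
    {π : List ((S × A) × Z) → S → A → ℝ} (hπ : IsPolicy π) {g : S × A → Z → ℝ}
    (hg : ∀ x, IsDist (g x)) (h : List ((S × A) × Z)) (xs : List (S × A)) :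
    0 ≤ simWeight π g h xs := by
  induction xs generalizing h with
  | nil => exact zero_le_one
  | cons x xs ih =>
    exact mul_nonneg ((hπ _ _).1 _) (sum_nonneg fun z _ => mul_nonneg ((hg x).1 z) (ih _))

lemma sum_simWeight_append_singleton {S A Z : Type*} [Fintype A] [Fintype Z]
    {π : List ((S × A) × Z) → S → A → ℝ} (hπ : IsPolicy π) {g : S × A → Z → ℝ}
    (hg : ∀ x, IsDist (g x)) (h : List ((S × A) × Z)) (xs : List (S × A)) (s : S) :
    ∑ a, simWeight π g h (xs ++ [(s, a)]) = simWeight π g h xs := by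
  induction xs generalizing h with
  | nil => simp [simWeight, (hg _).2, (hπ h s).2]
  | cons x xs ih =>
    simp only [List.cons_append, simWeight]
    rw [← mul_sum, sum_comm]
    simp only [← mul_sum, ih]

lemma sum_policyWeight_mul_prod {S A Z : Type*} [Fintype Z] {H : ℕ}
    (π : List ((S × A) × Z) → S → A → ℝ) (g : S × A → Z → ℝ) (h : List ((S × A) × Z))
    (x : Fin H → S × A) :
    ∑ z : Fin H → Z, (policyWeight (fun l => π (h ++ l)) (fun t => (x t, z t)) *
      ∏ t, g (x t) (z t)) = simWeight π g h (List.ofFn x) := by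
  induction H generalizing h with
  | zero => simp [policyWeight, simWeight]
  | succ H ih =>
    rw [List.ofFn_succ, simWeight, ← (Fin.consEquiv fun _ => Z).sum_comp,
      Fintype.sum_prod_type, mul_sum]
    refine sum_congr rfl fun z₀ _ => ?_
    rw [← ih (h ++ [(x 0, z₀)]) (fun t => x t.succ), mul_sum, mul_sum]
    refine sum_congr rfl fun z _ => ?_
    simp only [policyWeight, Fin.prod_univ_succ, Fin.consEquiv, Equiv.coe_fn_mk,
      Fin.cons_zero, Fin.cons_succ, List.ofFn_succ, Fin.val_zero, Fin.val_succ,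
      List.take_zero, List.take_succ_cons, List.append_nil, List.append_assoc,
      List.singleton_append]
    ring

/-- The reward-blind policy whose action probabilities are those of `π` when the rewards fed to
`π` are simulated from `g`. -/
noncomputable def simPolicy {S A Z : Type*} [Fintype Z] (π : List ((S × A) × Z) → S → A → ℝ)
    (g : S × A → Z → ℝ) : List ((S × A) × Z) → S → A → ℝ := fun h s a =>
  if simWeight π g [] (h.map Prod.fst) = 0 then π h s a
  else simWeight π g [] (h.map Prod.fst ++ [(s, a)]) / simWeight π g [] (h.map Prod.fst)

lemma isPolicy_simPolicy {S A Z : Type*} [Fintype A] [Fintype Z]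
    {π : List ((S × A) × Z) → S → A → ℝ} (hπ : IsPolicy π) {g : S × A → Z → ℝ}
    (hg : ∀ x, IsDist (g x)) : IsPolicy (simPolicy π g) := by
  intro h s
  by_cases h0 : simWeight π g [] (h.map Prod.fst) = 0
  · simpa [simPolicy, h0] using hπ h s
  · refine ⟨fun a => ?_, ?_⟩
    · simp only [simPolicy, h0, if_false]
      exact div_nonneg (simWeight_nonneg hπ hg _ _) (simWeight_nonneg hπ hg _ _)
    · simp only [simPolicy, h0, if_false]
      rw [← sum_div, sum_simWeight_append_singleton hπ hg, div_self h0]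

lemma simWeight_mul_simPolicy {S A Z : Type*} [Fintype A] [Fintype Z]
    {π : List ((S × A) × Z) → S → A → ℝ} (hπ : IsPolicy π) {g : S × A → Z → ℝ}
    (hg : ∀ x, IsDist (g x)) (h : List ((S × A) × Z)) (x : S × A) :
    simWeight π g [] (h.map Prod.fst) * simPolicy π g h x.1 x.2 =
      simWeight π g [] (h.map Prod.fst ++ [x]) := by
  by_cases h0 : simWeight π g [] (h.map Prod.fst) = 0
  · have hsum := sum_simWeight_append_singleton hπ hg [] (h.map Prod.fst) x.1
    rw [h0, sum_eq_zero_iff_of_nonneg fun _ _ => simWeight_nonneg hπ hg _ _] at hsum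
    rw [h0, zero_mul]
    exact (hsum x.2 (mem_univ _)).symm
  · simp only [simPolicy, h0, if_false]
    field_simp

lemma policyWeight_simPolicy {S A Z : Type*} [Fintype A] [Fintype Z] {H : ℕ}
    {π : List ((S × A) × Z) → S → A → ℝ} (hπ : IsPolicy π) {g : S × A → Z → ℝ}
    (hg : ∀ x, IsDist (g x)) (τ : Fin H → (S × A) × Z) :
    policyWeight (simPolicy π g) τ = simWeight π g [] (List.ofFn fun t => (τ t).1) := by
  induction H with
  | zero => simp [policyWeight, simWeight]
  | succ H ih =>
    have hmap : (List.ofFn fun t : Fin H => (τ t.castSucc).1) =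
        (List.ofFn fun t : Fin H => τ t.castSucc).map Prod.fst := by
      rw [List.map_ofFn]; rfl
    have htake : ∀ n ≤ H, (List.ofFn τ).take n =
        (List.ofFn fun t : Fin H => τ t.castSucc).take n := by
      intro n hn
      rw [List.ofFn_succ', List.concat_eq_append, List.take_append_of_le_length (by simpa)]
    rw [List.ofFn_succ', List.concat_eq_append, hmap, ← simWeight_mul_simPolicy hπ hg, ← hmap,
      ← ih]
    simp only [policyWeight]
    rw [Fin.prod_univ_castSucc]
    congr 1
    · refine prod_congr rfl fun t _ => ?_
      rw [Fin.val_castSucc, htake _ t.2.le]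
    · rw [Fin.val_last, htake _ le_rfl, List.take_of_length_le (by simp)]

lemma bddAbove_eventProb {S A Z : Type*} [Fintype S] [Fintype A] [Fintype Z] [DecidableEq S]
    [DecidableEq A] {H : ℕ} {T : S × A → S → ℝ} {ν : S → ℝ} (hT : ∀ x, IsDist (T x))
    (hν : IsDist ν) {M : ℕ} {w : Fin M → ℝ} {μ : Fin M → S × A → Z → ℝ} (hw : IsDist w)
    (hμ : IsRewardModel μ) (E : Finset (Fin H → S × A)) :
    BddAbove (Set.range fun π : {p : List ((S × A) × Z) → S → A → ℝ // IsPolicy p} =>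
      eventProb H T ν π.1 w μ E) := by
  refine ⟨∑ _τ : Fin H → (S × A) × Z, (1 : ℝ), ?_⟩
  rintro _ ⟨π, rfl⟩
  refine sum_le_sum fun τ _ => ?_
  split_ifs
  · rw [trajProb_eq]
    have hnn := mul_nonneg (dynWeight_nonneg hT hν fun t => (τ t).1) (policyWeight_nonneg π.2 τ)
    have hle := mul_le_one₀ (dynWeight_le_one hT hν fun t => (τ t).1)
      (policyWeight_nonneg π.2 τ) (policyWeight_le_one π.2 τ)
    exact (mul_le_of_le_one_right hnn (momentOn_le_one hw hμ _ _ _)).trans hle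
  · exact zero_le_one

lemma sum_trajectory {X Z : Type*} [Fintype X] [Fintype Z] {H : ℕ}
    (F : (Fin H → X × Z) → ℝ) :
    ∑ τ, F τ = ∑ x : Fin H → X, ∑ z : Fin H → Z, F fun t => (x t, z t) := by
  rw [← (Equiv.arrowProdEquivProdArrow (Fin H) (fun _ => X) fun _ => Z).symm.sum_comp,
    Fintype.sum_prod_type]
  rfl

/-- The probability of a state-action event when rewards come from a single reward model is at
most the best probability of that event in any RMMDP with the same dynamics. -/
lemma sum_singleContext_le_supEventProb {S A Z : Type*} [Fintype S] [Fintype A] [Fintype Z]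
    [DecidableEq S] [DecidableEq A] {H : ℕ} {T : S × A → S → ℝ} {ν : S → ℝ}
    (hT : ∀ x, IsDist (T x)) (hν : IsDist ν) {M : ℕ} {w : Fin M → ℝ}
    {μ : Fin M → S × A → Z → ℝ} (hw : IsDist w) (hμ : IsRewardModel μ)
    {π : List ((S × A) × Z) → S → A → ℝ} (hπ : IsPolicy π) {g : S × A → Z → ℝ}
    (hg : ∀ x, IsDist (g x)) (E : Finset (Fin H → S × A)) :
    ∑ τ : Fin H → (S × A) × Z, (if (fun t => (τ t).1) ∈ E then
      dynWeight H T ν (fun t => (τ t).1) * policyWeight π τ * ∏ t, g (τ t).1 (τ t).2 else 0)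
      ≤ supEventProb H T ν w μ E := by
  refine le_of_eq_of_le ?_ (le_ciSup (bddAbove_eventProb hT hν hw hμ E)
    ⟨simPolicy π g, isPolicy_simPolicy hπ hg⟩)
  refine (sum_trajectory _).trans (Eq.trans ?_ (sum_trajectory _).symm)
  refine sum_congr rfl fun x _ => ?_
  by_cases hx : x ∈ E
  · simp only [hx, if_true, trajProb_eq, policyWeight_simPolicy hπ hg]
    rw [← mul_sum, sum_momentOn_univ hw hμ, mul_one, ← sum_policyWeight_mul_prod, mul_sum]
    refine sum_congr rfl fun z _ => ?_
    rw [mul_assoc]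
    rfl
  · simp [hx]

/-- Closeness of the low-degree moments of two integral mixtures forces closeness of the full
moments, relative to the total likelihood of the individual contexts. -/
lemma abs_momentOn_sub_le {X Z : Type*} {M H P d : ℕ} (hP : 0 < P) {w₁ w₂ : Fin M → ℝ}
    {μ₁ μ₂ : Fin M → X → Z → ℝ}
    (hμ₁ : ∀ m x z, ∃ i : ℕ, i ≤ P ∧ μ₁ m x z = (i : ℝ) / P)
    (hμ₂ : ∀ m x z, ∃ i : ℕ, i ≤ P ∧ μ₂ m x z = (i : ℝ) / P)
    (hd : H ≤ d ∨ P ^ d * (2 * M) < (P + 1) ^ d) (x : Fin H → X) (z : Fin H → Z) {δ : ℝ}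
    (hδ : ∀ I : Finset (Fin H), #I ≤ d →
      |momentOn w₁ μ₁ x z I - momentOn w₂ μ₂ x z I| ≤ δ) :
    |momentOn w₁ μ₁ x z univ - momentOn w₂ μ₂ x z univ| ≤
      ((2 * M : ℕ) : ℝ) * ((2 * M).factorial * ((P ^ d : ℕ) : ℝ) ^ (2 * M) *
        ∑ k : Fin M ⊕ Fin M, ∏ t, Sum.elim μ₁ μ₂ k (x t) (z t)) * δ := by
  have hcard : Fintype.card (Fin M ⊕ Fin M) = 2 * M := by simp [two_mul]
  set v : Fin M ⊕ Fin M → Fin H → ℝ := fun k t => Sum.elim μ₁ μ₂ k (x t) (z t) with hv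
  have hvP : ∀ k i, ∃ j : ℕ, j ≤ P ∧ v k i = (j : ℝ) / P := by
    rintro (m | m) i
    · exact hμ₁ m _ _
    · exact hμ₂ m _ _
  have hv01 : ∀ k i, 0 ≤ v k i ∧ v k i ≤ 1 := by
    intro k i
    obtain ⟨j, hj, h⟩ := hvP k i
    rw [h]
    exact ⟨by positivity, div_le_one_of_le₀ (by exact_mod_cast hj) (by positivity)⟩
  have hfun : ∀ I : Finset (Fin H), momentOn w₁ μ₁ x z I - momentOn w₂ μ₂ x z I =
      ∑ k, Sum.elim w₁ (fun m => -w₂ m) k * ∏ i ∈ I, v k i := by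
    intro I
    simp [momentOn, hv, Fintype.sum_sum_type, sub_eq_add_neg]
  have hδ0 : 0 ≤ δ := (abs_nonneg _).trans (hδ ∅ (by simp))
  have hmem : (fun k => ∏ i, v k i) ∈ Submodule.span ℝ {u : Fin M ⊕ Fin M → ℝ |
      ∃ I : Finset (Fin H), #I ≤ d ∧ u = fun k => ∏ i ∈ I, v k i} := by
    rcases hd with hd | hd
    · exact Submodule.subset_span ⟨univ, by simpa using hd, rfl⟩
    · exact monomial_mem_span_card_le P v hvP d (by rwa [hcard]) univ
  have key := abs_functional_le_of_mem_span _ (P ^ d) (Nat.one_le_pow _ _ hP) ?_ ?_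
    (Sum.elim w₁ fun m => -w₂ m) δ hδ0 ?_ _ hmem
  · rw [hcard] at key
    rw [hfun]
    refine key.trans_eq ?_
    congr 3
    exact sum_congr rfl fun k _ => abs_of_nonneg (prod_nonneg fun i _ => (hv01 k i).1)
  · rintro _ ⟨I, -, rfl⟩ k
    rw [abs_of_nonneg (prod_nonneg fun i _ => (hv01 k i).1)]
    exact prod_le_one (fun i _ => (hv01 k i).1) fun i _ => (hv01 k i).2
  · rintro _ ⟨I, hI, rfl⟩ k
    choose j hjP hj using hvP k
    refine ⟨(P : ℤ) ^ (d - #I) * ∏ i ∈ I, (j i : ℤ), ?_⟩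
    have hP0 : (P : ℝ) ≠ 0 := by positivity
    simp only [hj, prod_div_distrib, prod_const]
    push_cast
    rw [← Nat.sub_add_cancel hI, pow_add, Nat.add_sub_cancel]
    field_simp
  · rintro _ ⟨I, hI, rfl⟩
    rw [← hfun]
    exact hδ I hI

/-- Moments along at most `d` positions of a long sequence are moments of a length-`d`
subsequence. -/
lemma exists_sublist_momentOn_eq {X Z : Type*} {H d : ℕ} (hdH : d ≤ H) (x : Fin H → X)
    (z : Fin H → Z) (I : Finset (Fin H)) (hI : #I ≤ d) :
    ∃ (y : Fin d → X) (r : Fin d → Z) (J : Finset (Fin d)),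
      (List.ofFn y).Sublist (List.ofFn x) ∧
      ∀ (M : ℕ) (w : Fin M → ℝ) (μ : Fin M → X → Z → ℝ),
        momentOn w μ x z I = momentOn w μ y r J := by
  obtain ⟨D, hID, -, hD⟩ := exists_subsuperset_card_eq (subset_univ I) hI (by simpa using hdH)
  let f : Fin d ↪o Fin H := D.orderEmbOfFin hD
  have hImage : (univ.filter fun i => f i ∈ I).map f.toEmbedding = I := by
    ext t
    simp only [mem_map, mem_filter, mem_univ, true_and, RelEmbedding.coe_toEmbedding]
    constructor
    · rintro ⟨i, hi, rfl⟩
      exact hi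
    · intro ht
      obtain ⟨i, hi⟩ : t ∈ Set.range f := by
        rw [range_orderEmbOfFin]
        exact hID ht
      exact ⟨i, hi ▸ ht, hi⟩
  refine ⟨x ∘ f, z ∘ f, univ.filter fun i => f i ∈ I, ?_, fun M w μ => ?_⟩
  · rw [List.sublist_iff_exists_fin_orderEmbedding_get_eq]
    refine ⟨(Fin.castOrderIso (by simp)).toOrderEmbedding.trans
      (f.trans (Fin.castOrderIso (by simp)).toOrderEmbedding), fun i => ?_⟩
    simp
    rfl
  · conv_lhs => rw [← hImage]
    simp [momentOn]

lemma mul_pow_lt_pow_of_log_div_log_lt {M P e : ℕ} (hM : 0 < M) (hP : 0 < P)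
    (he : Real.log (2 * M) / Real.log (((P : ℝ) + 1) / P) < e) :
    P ^ e * (2 * M) < (P + 1) ^ e := by
  have hP' : (0 : ℝ) < P := by exact_mod_cast hP
  have hM' : (0 : ℝ) < M := by exact_mod_cast hM
  have h1 : 1 < ((P : ℝ) + 1) / P := by rw [lt_div_iff₀ hP']; linarith
  rw [div_lt_iff₀ (Real.log_pos h1), ← Real.log_pow, Real.log_lt_log_iff (by positivity)
    (by positivity), div_pow, lt_div_iff₀ (by positivity)] at he
  have : (P : ℝ) ^ e * (2 * M) < ((P : ℝ) + 1) ^ e := by linarith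
  exact_mod_cast this

lemma half_le_log_two_mul {M : ℕ} (hM : 0 < M) : 1 / 2 ≤ Real.log (2 * M) := by
  have hM' : (1 : ℝ) ≤ M := by exact_mod_cast hM
  have : Real.log 2 ≤ Real.log (2 * M) := Real.log_le_log (by norm_num) (by linarith)
  linarith [Real.log_two_gt_d9]

lemma floor_log_div_log_add_one_le {M P : ℕ} (hM : 0 < M) (hP : 0 < P) :
    ((Nat.floor (Real.log (2 * M) / Real.log (((P : ℝ) + 1) / P)) + 1 : ℕ) : ℝ) ≤
      4 * P * Real.log (2 * M) := by
  have hP' : (1 : ℝ) ≤ P := by exact_mod_cast hP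
  have hlog := half_le_log_two_mul hM
  have h1 : (1 : ℝ) / (P + 1) ≤ Real.log (((P : ℝ) + 1) / P) := by
    refine le_trans (le_of_eq ?_) (Real.one_sub_inv_le_log_of_pos (by positivity))
    field_simp
    ring
  have h2 : Real.log (2 * M) / Real.log (((P : ℝ) + 1) / P) ≤ (P + 1) * Real.log (2 * M) := by
    rw [div_le_iff₀ (lt_of_lt_of_le (by positivity) h1)]
    rw [div_le_iff₀ (by positivity)] at h1
    nlinarith
  have h3 := Nat.floor_le (a := Real.log (2 * M) / Real.log (((P : ℝ) + 1) / P))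
    (div_nonneg (by linarith) (le_trans (by positivity) h1))
  push_cast
  nlinarith

lemma card_factor_le_rpow {M P d : ℕ} (hM : 0 < M) (hP : 0 < P)
    (hd : (d : ℝ) ≤ 4 * P * Real.log (2 * M)) :
    ((2 * M : ℕ) : ℝ) * ((2 * M).factorial * ((P ^ d : ℕ) : ℝ) ^ (2 * M)) * ((2 * M : ℕ) : ℝ) ≤
      (2 * M : ℝ) ^ ((16 : ℝ) * M * P * Real.log ((P : ℝ) + 1)) := by
  have hP' : (1 : ℝ) ≤ P := by exact_mod_cast hP
  have hM' : (1 : ℝ) ≤ M := by exact_mod_cast hM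
  have hlog := half_le_log_two_mul hM
  have hlogP : 2 / 3 ≤ Real.log ((P : ℝ) + 1) := by
    have : Real.log 2 ≤ Real.log ((P : ℝ) + 1) := Real.log_le_log (by norm_num) (by linarith)
    linarith [Real.log_two_gt_d9]
  have hfact : ((2 * M).factorial : ℝ) ≤ (2 * M : ℝ) ^ (2 * M) := by
    exact_mod_cast Nat.factorial_le_pow (2 * M)
  have hpow : ((P ^ d : ℕ) : ℝ) ^ (2 * M) ≤
      Real.exp (8 * M * P * Real.log ((P : ℝ) + 1) * Real.log (2 * M)) := by
    have hlogP0 : 0 ≤ Real.log (P : ℝ) := Real.log_nonneg hP'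
    have hlogle : Real.log (P : ℝ) ≤ Real.log ((P : ℝ) + 1) :=
      Real.log_le_log (by linarith) (by linarith)
    rw [← Real.log_le_iff_le_exp (by positivity)]
    push_cast
    rw [Real.log_pow, Real.log_pow]
    push_cast
    calc 2 * (M : ℝ) * (d * Real.log P)
        ≤ 2 * M * (4 * P * Real.log (2 * M) * Real.log ((P : ℝ) + 1)) := by gcongr
      _ = _ := by ring
  have hbase : (2 * M : ℝ) ^ (2 * M + 2) ≤
      Real.exp (6 * M * P * Real.log ((P : ℝ) + 1) * Real.log (2 * M)) := by
    rw [← Real.log_le_iff_le_exp (by positivity), Real.log_pow]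
    push_cast
    refine mul_le_mul_of_nonneg_right ?_ (by linarith)
    have : (2 / 3 : ℝ) ≤ P * Real.log ((P : ℝ) + 1) := by nlinarith
    nlinarith
  calc _ ≤ ((2 * M : ℕ) : ℝ) * ((2 * M : ℝ) ^ (2 * M) *
        Real.exp (8 * M * P * Real.log ((P : ℝ) + 1) * Real.log (2 * M))) *
          ((2 * M : ℕ) : ℝ) := by gcongr
    _ = (2 * M : ℝ) ^ (2 * M + 2) *
        Real.exp (8 * M * P * Real.log ((P : ℝ) + 1) * Real.log (2 * M)) := by
      push_cast
      ring
    _ ≤ Real.exp (6 * M * P * Real.log ((P : ℝ) + 1) * Real.log (2 * M)) *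
        Real.exp (8 * M * P * Real.log ((P : ℝ) + 1) * Real.log (2 * M)) := by gcongr
    _ ≤ (2 * M : ℝ) ^ ((16 : ℝ) * M * P * Real.log ((P : ℝ) + 1)) := by
      rw [← Real.exp_add, Real.rpow_def_of_pos (by positivity)]
      refine Real.exp_le_exp.mpr ?_
      have : 0 ≤ M * P * Real.log ((P : ℝ) + 1) * Real.log (2 * M) := by positivity
      nlinarith

/-- Modified eventwise total-variation bound for integral reward
probabilities.  There is a universal constant `C > 0` such that for any two RMMDPs with
`M` contexts sharing `T, ν`, whose reward probabilities are all integral multiples of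
`1/P`, with `d = min(d_P, H)` where `d_P = ⌊ln(2M)/ln((P+1)/P)⌋ + 1`, the statistical
distance of trajectories restricted to any well-explored `E' ⊆ E_l` is at most
`sup_{π'} P⁽¹⁾_{π'}(x_{1:H} ∈ E') · (2M)^{C·M·P·ln(P+1)} · δ_l`. -/
theorem statement4 :
    ∃ C : ℝ, 0 < C ∧
      ∀ (S A Z : Type) [Fintype S] [Fintype A] [Fintype Z]
        [DecidableEq S] [DecidableEq A]
        (P : ℕ), 0 < P →
      ∀ (H : ℕ) (T : S × A → S → ℝ) (ν : S → ℝ),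
        (∀ x, IsDist (T x)) → IsDist ν →
      ∀ (M : ℕ)
        (w₁ : Fin M → ℝ) (μ₁ : Fin M → S × A → Z → ℝ)
        (w₂ : Fin M → ℝ) (μ₂ : Fin M → S × A → Z → ℝ),
        IsDist w₁ → IsDist w₂ → IsRewardModel μ₁ → IsRewardModel μ₂ →
        (∀ m x z, ∃ i : ℕ, i ≤ P ∧ μ₁ m x z = (i : ℝ) / P) →
        (∀ m x z, ∃ i : ℕ, i ≤ P ∧ μ₂ m x z = (i : ℝ) / P) →
      ∀ d : ℕ,
        d = min (Nat.floor (Real.log (2 * M) / Real.log (((P : ℝ) + 1) / P)) + 1) H →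
      ∀ (n : List (S × A) → ℝ) (n_l : ℝ), 0 < n_l →
      ∀ δ_l : ℝ,
        (∀ x : Fin d → S × A, n_l ≤ n (List.ofFn x) →
          ∀ (z : Fin d → Z) (I : Finset (Fin d)),
            |momentOn w₁ μ₁ x z I - momentOn w₂ μ₂ x z I| ≤ δ_l) →
      ∀ E' : Finset (Fin H → S × A),
        (∀ x ∈ E', ∀ xs : List (S × A), xs.length ≤ d →
          xs.Sublist (List.ofFn x) → n_l ≤ n xs) →
      ∀ π : List ((S × A) × Z) → S → A → ℝ, IsPolicy π →
      ∑ τ : Fin H → (S × A) × Z,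
          (if (fun t => (τ t).1) ∈ E' then
            |trajProb H T ν π w₁ μ₁ τ - trajProb H T ν π w₂ μ₂ τ| else 0)
        ≤ supEventProb H T ν w₁ μ₁ E'
            * (2 * M : ℝ) ^ (C * M * P * Real.log ((P : ℝ) + 1)) * δ_l := by
  refine ⟨16, by norm_num, ?_⟩
  intro S A Z _ _ _ _ _ P hP H T ν hT hν M w₁ μ₁ w₂ μ₂ hw₁ hw₂ hμ₁ hμ₂ hint₁ hint₂ d hd n n_l _
    δ hδ E' hE' π hπ
  have hM : 0 < M := by
    rcases Nat.eq_zero_or_pos M with rfl | h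
    · simp [IsDist] at hw₁
    · exact h
  set e := Nat.floor (Real.log (2 * M) / Real.log (((P : ℝ) + 1) / P)) + 1 with he
  have hdH : d ≤ H := hd ▸ min_le_right _ _
  have hdlog : (d : ℝ) ≤ 4 * P * Real.log (2 * M) :=
    le_trans (Nat.cast_le.mpr (hd ▸ min_le_left e H)) (floor_log_div_log_add_one_le hM hP)
  have hdeg : H ≤ d ∨ P ^ d * (2 * M) < (P + 1) ^ d := by
    rcases le_total H e with h | h
    · exact Or.inl (by rw [hd, min_eq_right h])
    · right
      rw [hd, min_eq_left h]
      refine mul_pow_lt_pow_of_log_div_log_lt hM hP ?_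
      rw [he]
      exact_mod_cast Nat.lt_floor_add_one _
  have hclose : ∀ τ : Fin H → (S × A) × Z, (fun t => (τ t).1) ∈ E' →
      ∀ I : Finset (Fin H), #I ≤ d →
        |momentOn w₁ μ₁ (fun t => (τ t).1) (fun t => (τ t).2) I -
          momentOn w₂ μ₂ (fun t => (τ t).1) (fun t => (τ t).2) I| ≤ δ := by
    intro τ hτ I hI
    obtain ⟨y, r, J, hsub, hmom⟩ :=
      exists_sublist_momentOn_eq hdH (fun t => (τ t).1) (fun t => (τ t).2) I hI
    rw [hmom, hmom]
    exact hδ y (hE' _ hτ _ (by simp) hsub) r J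
  by_cases hex : ∃ τ : Fin H → (S × A) × Z, (fun t => (τ t).1) ∈ E'
  · obtain ⟨τ₀, hτ₀⟩ := hex
    have hδ0 : 0 ≤ δ := (abs_nonneg _).trans (hclose τ₀ hτ₀ ∅ (by simp))
    have hdist : ∀ (k : Fin M ⊕ Fin M) x, IsDist (Sum.elim μ₁ μ₂ k x) := by
      rintro (m | m) x
      · exact hμ₁ m x
      · exact hμ₂ m x
    have hsup := fun k =>
      sum_singleContext_le_supEventProb hT hν hw₁ hμ₁ hπ (hdist k) E'
    have hsup0 : 0 ≤ supEventProb H T ν w₁ μ₁ E' := by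
      refine le_trans (sum_nonneg fun τ _ => ?_) (hsup (Sum.inl ⟨0, hM⟩))
      split_ifs
      · exact mul_nonneg (mul_nonneg (dynWeight_nonneg hT hν _) (policyWeight_nonneg hπ τ))
          (prod_nonneg fun t _ => (hdist _ _).1 _)
      · exact le_rfl
    set B : ℝ := ((2 * M : ℕ) : ℝ) * ((2 * M).factorial * ((P ^ d : ℕ) : ℝ) ^ (2 * M)) with hB
    have hB0 : 0 ≤ B := by positivity
    calc _ ≤ ∑ τ : Fin H → (S × A) × Z, ∑ k : Fin M ⊕ Fin M, B * δ *
          (if (fun t => (τ t).1) ∈ E' then dynWeight H T ν (fun t => (τ t).1) *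
            policyWeight π τ * ∏ t, Sum.elim μ₁ μ₂ k (τ t).1 (τ t).2 else 0) := by
          refine sum_le_sum fun τ _ => ?_
          split_ifs with hτ
          · have hbase := mul_nonneg (dynWeight_nonneg hT hν fun t => (τ t).1)
              (policyWeight_nonneg hπ τ)
            rw [trajProb_eq, trajProb_eq, ← mul_sub, abs_mul, abs_of_nonneg hbase]
            refine (mul_le_mul_of_nonneg_left (abs_momentOn_sub_le hP hint₁ hint₂ hdeg _ _
              (hclose τ hτ)) hbase).trans_eq ?_
            simp only [← mul_sum, hB]
            ring
          · simp
      _ = B * δ * ∑ k : Fin M ⊕ Fin M, ∑ τ : Fin H → (S × A) × Z,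
          (if (fun t => (τ t).1) ∈ E' then dynWeight H T ν (fun t => (τ t).1) *
            policyWeight π τ * ∏ t, Sum.elim μ₁ μ₂ k (τ t).1 (τ t).2 else 0) := by
          rw [sum_comm]
          simp only [mul_sum]
      _ ≤ B * δ * ∑ _k : Fin M ⊕ Fin M, supEventProb H T ν w₁ μ₁ E' := by
          gcongr with k
          exact hsup k
      _ = supEventProb H T ν w₁ μ₁ E' * (B * ((2 * M : ℕ) : ℝ)) * δ := by
          simp only [sum_const, card_univ, Fintype.card_sum, Fintype.card_fin, nsmul_eq_mul]
          push_cast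
          ring
      _ ≤ _ := by
          gcongr
          exact card_factor_le_rpow hM hP hdlog
  · push Not at hex
    simp [supEventProb, eventProb, hex]
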